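/- There exists an absolute constant c > 0 with the following property: if a finite-dimensional real normed space X contains an m-dimensional linear subspace Y (with the induced norm) whose Banach–Mazur distance to ℓ₂^m satisfies d(Y, ℓ₂^m) ≤ 3/2, then e(X) ≥ c·m^{1/3}. -/

import Mathlib

/-- A set `S` in a normed space is *equilateral* if there is a common distance `d > 0`
between any two distinct points of `S`. -/
def IsEquilateral {X : Type*} [NormedAddCommGroup X] (S : Set X) : Prop :=
  ∃ d : ℝ, 0 < d ∧ ∀ x ∈ S, ∀ y ∈ S, x ≠ y → ‖x - y‖ = d

/-- The Banach–Mazur distance `d(X, Y) = inf ‖T‖ ‖T⁻¹‖`, the infimum taken over all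
(continuous) linear isomorphisms `T : X → Y`. -/
noncomputable def BMdist (X Y : Type*) [NormedAddCommGroup X] [NormedSpace ℝ X]
    [NormedAddCommGroup Y] [NormedSpace ℝ Y] : ℝ :=
  sInf {r : ℝ | ∃ T : X ≃L[ℝ] Y, r = ‖(T : X →L[ℝ] Y)‖ * ‖(T.symm : Y →L[ℝ] X)‖}

open MeasureTheory ProbabilityTheory Real
open scoped ENNReal

section Gaussian
variable {E : Type*} [NormedAddCommGroup E] [InnerProductSpace ℝ E] [FiniteDimensional ℝ E]
  [MeasurableSpace E] [BorelSpace E]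
  {F : Type*} [NormedAddCommGroup F] [NormedSpace ℝ F]

lemma map_strongDual_stdGaussian (L : StrongDual ℝ E) :
    (stdGaussian E).map L = gaussianReal 0 (‖L‖ ^ 2).toNNReal := by
  rw [IsGaussian.map_eq_gaussianReal, integral_strongDual_stdGaussian, variance_dual_stdGaussian]

lemma lintegral_exp_strongDual_stdGaussian (L : StrongDual ℝ E) :
    ∫⁻ x, ENNReal.ofReal (exp (L x)) ∂(stdGaussian E) = ENNReal.ofReal (exp (‖L‖ ^ 2 / 2)) := by
  have h := mgf_gaussianReal (map_strongDual_stdGaussian L) 1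
  have hi : Integrable (fun x => exp (L x)) (stdGaussian E) := by
    have := integrable_exp_mul_gaussianReal (μ := 0) (v := (‖L‖ ^ 2).toNNReal) 1
    rw [← map_strongDual_stdGaussian L] at this
    simpa [Function.comp_def] using this.comp_measurable (f := L) (by fun_prop)
  rw [← ofReal_integral_eq_lintegral_ofReal hi (by filter_upwards with x; positivity)]
  simp [mgf] at h
  rw [h]

lemma integrable_exp_mul_norm_stdGaussian (K : ℝ) :
    Integrable (fun x => exp (K * ‖x‖)) (stdGaussian E) := by
  obtain ⟨C, hC, hi⟩ := IsGaussian.exists_integrable_exp_sq (stdGaussian E)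
  refine (hi.const_mul (exp (K ^ 2 / (4 * C)))).mono' (by fun_prop) ?_
  filter_upwards with x
  rw [norm_of_nonneg (exp_pos _).le, ← exp_add]
  gcongr
  have : K ^ 2 / (4 * C) + C * ‖x‖ ^ 2 - K * ‖x‖ = (K - 2 * C * ‖x‖) ^ 2 / (4 * C) := by
    field_simp; ring
  have h2 : 0 ≤ (K - 2 * C * ‖x‖) ^ 2 / (4 * C) := by positivity
  linarith

lemma tendsto_integral_exp_mul_norm_stdGaussian (K : ℝ) (hK : 0 ≤ K) :
    Filter.Tendsto (fun n : ℕ => ∫ x, exp (K / n * ‖x‖) ∂(stdGaussian E)) Filter.atTop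
      (nhds 1) := by
  have h := tendsto_integral_filter_of_dominated_convergence (μ := stdGaussian E)
    (F := fun (n : ℕ) x => exp (K / n * ‖x‖)) (f := fun _ => 1) (l := Filter.atTop)
    (fun x => exp (K * ‖x‖)) (by filter_upwards with n; fun_prop) ?_
    (integrable_exp_mul_norm_stdGaussian K) ?_
  · simpa using h
  · filter_upwards [Filter.eventually_ge_atTop 1] with n hn
    filter_upwards with x
    rw [norm_of_nonneg (exp_pos _).le]
    gcongr
    exact div_le_self hK (by exact_mod_cast hn)
  · filter_upwards with x
    have := (tendsto_const_div_atTop_nhds_zero_nat K).mul_const ‖x‖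
    simpa [Function.comp_def] using (continuous_exp.tendsto _).comp this

/-- One step of the rotation argument: conditionally on the first vector, the increment of the norm
is dominated by a linear functional of the second one. -/
lemma lintegral_exp_norm_sub_norm_rotate_le (A : E →L[ℝ] F) (hA : ∀ x, ‖A x‖ ≤ ‖x‖)
    {a h : ℝ} (ha : 0 ≤ a) :
    ∫⁻ p, ENNReal.ofReal (exp (a * (‖A p.1‖ - ‖A (cos h • p.1 + sin h • p.2)‖)))
      ∂((stdGaussian E).prod (stdGaussian E)) ≤
    ENNReal.ofReal (exp ((a * sin h) ^ 2 / 2)) *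
      ∫⁻ x, ENNReal.ofReal (exp (a * (1 - cos h) * ‖x‖)) ∂(stdGaussian E) := by
  rw [lintegral_prod _ (by fun_prop), ← lintegral_const_mul _ (by fun_prop)]
  refine lintegral_mono fun x => ?_
  obtain ⟨g, hg, hgx⟩ := exists_dual_vector'' ℝ (A x)
  set G : StrongDual ℝ E := g ∘L A
  have hG : ‖G‖ ≤ 1 := by
    refine ContinuousLinearMap.opNorm_le_bound _ zero_le_one fun y => ?_
    calc ‖g (A y)‖ ≤ ‖g‖ * ‖A y‖ := g.le_opNorm _
      _ ≤ 1 * ‖y‖ := by gcongr; exact hA y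
  have key : ∀ y, a * (‖A x‖ - ‖A (cos h • x + sin h • y)‖) ≤
      a * (1 - cos h) * ‖x‖ + (-(a * sin h) • G) y := by
    intro y
    have h1 : g (A (cos h • x + sin h • y)) ≤ ‖A (cos h • x + sin h • y)‖ := by
      refine (le_abs_self _).trans ((g.le_opNorm _).trans ?_)
      exact mul_le_of_le_one_left (norm_nonneg _) hg
    have h2 : g (A (cos h • x + sin h • y)) = cos h * ‖A x‖ + sin h * G y := by
      simp [G]; left; simpa using hgx
    have h3 : (1 - cos h) * ‖A x‖ ≤ (1 - cos h) * ‖x‖ :=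
      mul_le_mul_of_nonneg_left (hA x) (by linarith [cos_le_one h])
    have h4 : ‖A x‖ - ‖A (cos h • x + sin h • y)‖ ≤ (1 - cos h) * ‖x‖ - sin h * G y := by
      linarith
    have := mul_le_mul_of_nonneg_left h4 ha
    simp only [smul_apply, smul_eq_mul]
    linarith
  calc ∫⁻ y, ENNReal.ofReal (exp (a * (‖A x‖ - ‖A (cos h • x + sin h • y)‖))) ∂(stdGaussian E)
      ≤ ∫⁻ y, ENNReal.ofReal (exp (a * (1 - cos h) * ‖x‖)) *
          ENNReal.ofReal (exp ((-(a * sin h) • G) y)) ∂(stdGaussian E) := by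
        refine lintegral_mono fun y => ?_
        rw [← ENNReal.ofReal_mul (exp_pos _).le, ← exp_add]
        gcongr
        exact key y
    _ = ENNReal.ofReal (exp (a * (1 - cos h) * ‖x‖)) *
          ENNReal.ofReal (exp (‖-(a * sin h) • G‖ ^ 2 / 2)) := by
        rw [lintegral_const_mul _ (by fun_prop), lintegral_exp_strongDual_stdGaussian]
    _ ≤ _ := by
        rw [mul_comm]
        refine mul_le_mul_left (ENNReal.ofReal_le_ofReal (exp_le_exp.2 ?_)) _
        refine div_le_div_of_nonneg_right ?_ zero_le_two
        rw [norm_smul, norm_neg, norm_eq_abs, mul_pow, sq_abs]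
        exact mul_le_of_le_one_right (sq_nonneg _) (pow_le_one₀ (norm_nonneg _) hG)

lemma lintegral_comp_rotation (θ : ℝ) {f : E × E → ℝ≥0∞} (hf : Measurable f) :
    ∫⁻ p, f (ContinuousLinearMap.rotation θ p) ∂((stdGaussian E).prod (stdGaussian E)) =
      ∫⁻ p, f p ∂((stdGaussian E).prod (stdGaussian E)) := by
  conv_rhs => rw [← IsGaussian.map_rotation_eq_self (μ := stdGaussian E) (by simp) θ]
  rw [lintegral_map hf (by fun_prop)]

/-- Exponential moments of the difference of a norm at two independent Gaussian vectors. -/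
lemma lintegral_exp_norm_sub_norm_le (A : E →L[ℝ] F) (hA : ∀ x, ‖A x‖ ≤ ‖x‖)
    {a : ℝ} (ha : 0 ≤ a) :
    ∫⁻ p, ENNReal.ofReal (exp (a * (‖A p.1‖ - ‖A p.2‖)))
      ∂((stdGaussian E).prod (stdGaussian E)) ≤ ENNReal.ofReal (2 * exp (2 * a ^ 2)) := by
  obtain ⟨n, hn2, hn1⟩ := (((tendsto_integral_exp_mul_norm_stdGaussian (E := E) (a * 2)
    (by positivity)).eventually (gt_mem_nhds one_lt_two)).and
      (Filter.eventually_ge_atTop 1)).exists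
  have hn0 : (0 : ℝ) < n := by exact_mod_cast hn1
  set h : ℝ := π / 2 / n with hh
  have hnh : n * h = π / 2 := by rw [hh]; field_simp
  have hpos : 0 < h := by positivity
  have hpi := pi_lt_four
  set Z : ℕ → E × E → E := fun k p => cos (k * h) • p.1 + sin (k * h) • p.2 with hZ
  have hstep : ∀ k p, Z (k + 1) p =
      cos h • (ContinuousLinearMap.rotation (k * h) p).1 +
        sin h • (ContinuousLinearMap.rotation (k * h) p).2 := by
    intro k p
    simp only [hZ, ContinuousLinearMap.rotation_apply]
    push_cast
    rw [add_mul, one_mul, cos_add, sin_add]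
    module
  have hpt : ∀ p : E × E, exp (a * (‖A p.1‖ - ‖A p.2‖)) ≤
      ∑ k ∈ Finset.range n, (1 / n : ℝ) * exp (n * a * (‖A (Z k p)‖ - ‖A (Z (k + 1) p)‖)) := by
    intro p
    have h0 : Z 0 p = p.1 := by simp [hZ]
    have h1 : Z n p = p.2 := by simp [hZ, hnh]
    have htel : ‖A p.1‖ - ‖A p.2‖ =
        ∑ k ∈ Finset.range n, (‖A (Z k p)‖ - ‖A (Z (k + 1) p)‖) := by
      rw [Finset.sum_range_sub' (fun k => ‖A (Z k p)‖), h0, h1]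
    have := convexOn_exp.map_sum_le (t := Finset.range n) (w := fun _ => (1 / n : ℝ))
      (p := fun k => n * a * (‖A (Z k p)‖ - ‖A (Z (k + 1) p)‖))
      (fun _ _ => by positivity) (by simp; field_simp) (fun _ _ => Set.mem_univ _)
    simp only [smul_eq_mul] at this
    refine le_trans (le_of_eq ?_) this
    rw [htel, Finset.mul_sum]
    congr 1
    refine Finset.sum_congr rfl fun k _ => ?_
    field_simp
  set I := ∫⁻ p, ENNReal.ofReal (exp (n * a * (‖A p.1‖ - ‖A (cos h • p.1 + sin h • p.2)‖)))
      ∂((stdGaussian E).prod (stdGaussian E)) with hI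
  have hk : ∀ k : ℕ, ∫⁻ p, ENNReal.ofReal (exp (n * a * (‖A (Z k p)‖ - ‖A (Z (k + 1) p)‖)))
      ∂((stdGaussian E).prod (stdGaussian E)) = I := by
    intro k
    rw [hI]
    refine Eq.trans ?_ (lintegral_comp_rotation (k * h) (by fun_prop))
    exact lintegral_congr fun p => by rw [hstep]; rfl
  calc _ ≤ ∫⁻ p, ∑ k ∈ Finset.range n, ENNReal.ofReal (1 / n) *
          ENNReal.ofReal (exp (n * a * (‖A (Z k p)‖ - ‖A (Z (k + 1) p)‖)))
          ∂((stdGaussian E).prod (stdGaussian E)) := by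
        refine lintegral_mono fun p => ?_
        refine (ENNReal.ofReal_le_ofReal (hpt p)).trans (le_of_eq ?_)
        rw [ENNReal.ofReal_sum_of_nonneg (fun _ _ => by positivity)]
        exact Finset.sum_congr rfl fun k _ => ENNReal.ofReal_mul (by positivity)
    _ = I := by
        rw [lintegral_finsetSum _ (by intro k _; fun_prop)]
        simp_rw [lintegral_const_mul' _ _ ENNReal.ofReal_ne_top, hk]
        rw [Finset.sum_const, Finset.card_range, nsmul_eq_mul, ← mul_assoc,
          ← ENNReal.ofReal_natCast n, ← ENNReal.ofReal_mul hn0.le, mul_one_div_cancel hn0.ne']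
        simp
    _ ≤ _ := lintegral_exp_norm_sub_norm_rotate_le A hA (by positivity)
    _ ≤ ENNReal.ofReal (exp (2 * a ^ 2)) * ENNReal.ofReal 2 := by
        gcongr
        · have h1 : sin h ≤ h := sin_le hpos.le
          have h0 : 0 ≤ sin h := sin_nonneg_of_nonneg_of_le_pi hpos.le (by
            rw [hh]
            have : (1 : ℝ) ≤ n := by exact_mod_cast hn1
            calc π / 2 / n ≤ π / 2 := div_le_self (by positivity) this
              _ ≤ π := by linarith [pi_pos])
          have h2 : n * a * sin h ≤ 2 * a := by
            calc n * a * sin h ≤ n * a * h := by gcongr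
              _ = a * (n * h) := by ring
              _ ≤ 2 * a := by rw [hnh]; nlinarith
          have h3 : (n * a * sin h) ^ 2 ≤ (2 * a) ^ 2 :=
            pow_le_pow_left₀ (by positivity) h2 2
          nlinarith
        · have hint := integrable_exp_mul_norm_stdGaussian (E := E) (a * 2 / n)
          calc _ ≤ ∫⁻ x, ENNReal.ofReal (exp (a * 2 / n * ‖x‖)) ∂(stdGaussian E) := by
                refine lintegral_mono fun x => ?_
                gcongr
                have h1 := one_sub_sq_div_two_le_cos (x := h)
                have h2 : n * h ^ 2 / 2 ≤ 2 / n := by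
                  have : n * h ^ 2 / 2 = (π / 2) ^ 2 / 2 / n := by rw [hh]; field_simp
                  rw [this]
                  gcongr
                  nlinarith [pi_pos]
                calc n * a * (1 - cos h) ≤ n * a * (h ^ 2 / 2) := by gcongr; linarith
                  _ = a * (n * h ^ 2 / 2) := by ring
                  _ ≤ a * (2 / n) := by gcongr
                  _ = _ := by ring
            _ ≤ _ := by
                rw [← ofReal_integral_eq_lintegral_ofReal hint
                  (by filter_upwards with x; positivity)]
                exact ENNReal.ofReal_le_ofReal hn2.le
    _ = _ := by rw [← ENNReal.ofReal_mul (by positivity), mul_comm]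

lemma integrable_norm_apply_stdGaussian (A : E →L[ℝ] F) :
    Integrable (fun x => ‖A x‖) (stdGaussian E) := by
  have h : Integrable (fun x : E => x) (stdGaussian E) := IsGaussian.integrable_id
  refine (h.norm.const_mul ‖A‖).mono' (by fun_prop) ?_
  filter_upwards with x
  rw [norm_norm]
  exact A.le_opNorm x

lemma lintegral_exp_norm_sub_mean_le (A : E →L[ℝ] F) (hA : ∀ x, ‖A x‖ ≤ ‖x‖) (a : ℝ) :
    ∫⁻ x, ENNReal.ofReal (exp (a * (‖A x‖ - ∫ y, ‖A y‖ ∂(stdGaussian E)))) ∂(stdGaussian E) ≤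
      ∫⁻ p, ENNReal.ofReal (exp (a * (‖A p.1‖ - ‖A p.2‖)))
        ∂((stdGaussian E).prod (stdGaussian E)) := by
  rw [lintegral_prod _ (by fun_prop)]
  refine lintegral_mono fun x => ?_
  have hnorm := integrable_norm_apply_stdGaussian (E := E) A
  have hint : Integrable (fun y => exp (a * (‖A x‖ - ‖A y‖))) (stdGaussian E) := by
    refine ((integrable_exp_mul_norm_stdGaussian (E := E) |a|).const_mul
      (exp (a * ‖A x‖))).mono' (by fun_prop) ?_
    filter_upwards with y
    rw [norm_of_nonneg (exp_pos _).le, ← exp_add]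
    gcongr
    have h1 : -(a * ‖A y‖) ≤ |a| * ‖A y‖ := by
      rw [← neg_mul]; gcongr; exact neg_le_abs a
    have h2 : |a| * ‖A y‖ ≤ |a| * ‖y‖ := by gcongr; exact hA y
    linarith
  rw [← ofReal_integral_eq_lintegral_ofReal hint (by filter_upwards with y; positivity)]
  refine ENNReal.ofReal_le_ofReal ?_
  have := convexOn_exp.map_integral_le (μ := stdGaussian E)
    (f := fun y => a * (‖A x‖ - ‖A y‖)) continuous_exp.continuousOn isClosed_univ (by simp)
    (((integrable_const _).sub hnorm).const_mul a) hint
  rw [integral_const_mul, integral_sub (integrable_const _) hnorm] at this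
  simpa using this

/-- Gaussian concentration for a norm dominated by the Euclidean one. -/
theorem stdGaussian_abs_norm_sub_mean_ge_le (A : E →L[ℝ] F) (hA : ∀ x, ‖A x‖ ≤ ‖x‖)
    {r : ℝ} (hr : 0 ≤ r) :
    stdGaussian E {x | r ≤ |‖A x‖ - ∫ y, ‖A y‖ ∂(stdGaussian E)|} ≤
      ENNReal.ofReal (4 * exp (-r ^ 2 / 8)) := by
  set M := ∫ y, ‖A y‖ ∂(stdGaussian E) with hM
  have hpos : ∫⁻ x, ENNReal.ofReal (exp (r / 4 * (‖A x‖ - M))) ∂(stdGaussian E) ≤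
      ENNReal.ofReal (2 * exp (2 * (r / 4) ^ 2)) :=
    (lintegral_exp_norm_sub_mean_le A hA _).trans
      (lintegral_exp_norm_sub_norm_le A hA (by positivity))
  have hneg : ∫⁻ x, ENNReal.ofReal (exp (-(r / 4) * (‖A x‖ - M))) ∂(stdGaussian E) ≤
      ENNReal.ofReal (2 * exp (2 * (r / 4) ^ 2)) := by
    refine (lintegral_exp_norm_sub_mean_le A hA _).trans (le_trans (le_of_eq ?_)
      (lintegral_exp_norm_sub_norm_le A hA (a := r / 4) (by positivity)))
    rw [← lintegral_prod_swap]
    refine lintegral_congr fun p => ?_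
    simp only [Prod.fst_swap, Prod.snd_swap]
    ring_nf
  have markov : ∀ b : ℝ, ∫⁻ x, ENNReal.ofReal (exp (b * (‖A x‖ - M))) ∂(stdGaussian E) ≤
      ENNReal.ofReal (2 * exp (2 * (r / 4) ^ 2)) →
      stdGaussian E {x | r / 4 * r ≤ b * (‖A x‖ - M)} ≤
        ENNReal.ofReal (2 * exp (-r ^ 2 / 8)) := by
    intro b hb
    have h1 := meas_ge_le_lintegral_div (μ := stdGaussian E)
      (f := fun x => ENNReal.ofReal (exp (b * (‖A x‖ - M))))
      (Continuous.measurable (by fun_prop)).ennreal_ofReal.aemeasurable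
      (ε := ENNReal.ofReal (exp (r / 4 * r))) (by simp [exp_pos]) ENNReal.ofReal_ne_top
    calc stdGaussian E {x | r / 4 * r ≤ b * (‖A x‖ - M)}
        ≤ _ := measure_mono fun x hx => ENNReal.ofReal_le_ofReal (exp_le_exp.2 hx)
      _ ≤ _ := h1
      _ ≤ ENNReal.ofReal (2 * exp (2 * (r / 4) ^ 2)) / ENNReal.ofReal (exp (r / 4 * r)) := by
          gcongr
      _ = _ := by
          rw [← ENNReal.ofReal_div_of_pos (exp_pos _), mul_div_assoc, ← exp_sub]
          congr 3
          ring
  calc stdGaussian E {x | r ≤ |‖A x‖ - M|}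
      ≤ stdGaussian E ({x | r / 4 * r ≤ r / 4 * (‖A x‖ - M)} ∪
          {x | r / 4 * r ≤ -(r / 4) * (‖A x‖ - M)}) := by
        refine measure_mono fun x hx => ?_
        rcases le_abs.1 (show r ≤ |‖A x‖ - M| from hx) with h | h
        · left
          exact mul_le_mul_of_nonneg_left h (by positivity)
        · right
          have := mul_le_mul_of_nonneg_left h (show 0 ≤ r / 4 by positivity)
          change r / 4 * r ≤ -(r / 4) * (‖A x‖ - M)
          linarith
    _ ≤ _ := measure_union_le _ _
    _ ≤ ENNReal.ofReal (2 * exp (-r ^ 2 / 8)) + ENNReal.ofReal (2 * exp (-r ^ 2 / 8)) :=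
        add_le_add (markov _ hpos) (markov _ hneg)
    _ = _ := by
        rw [← ENNReal.ofReal_add (by positivity) (by positivity)]
        congr 1
        ring

lemma integral_abs_gaussianReal_pos : 0 < ∫ x, |x| ∂(gaussianReal 0 1) := by
  have hint : Integrable (fun x : ℝ => x) (gaussianReal 0 1) := IsGaussian.integrable_id
  rw [integral_pos_iff_support_of_nonneg (fun x => abs_nonneg x) hint.abs]
  have : Function.support (fun x : ℝ => |x|) = {0}ᶜ := by ext; simp
  have := nullSingletonClass_gaussianReal (μ := 0) (v := 1) one_ne_zero
  rw [‹Function.support _ = _›, prob_compl_eq_one_sub (measurableSet_singleton _)]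
  simp

/-- The mean Euclidean norm of a standard Gaussian vector in dimension `m` is of order `√m`. -/
lemma mul_sqrt_le_integral_norm_stdGaussian (m : ℕ) :
    (∫ x, |x| ∂(gaussianReal 0 1)) * √m ≤
      ∫ x, ‖x‖ ∂(stdGaussian (EuclideanSpace ℝ (Fin m))) := by
  rcases Nat.eq_zero_or_pos m with rfl | hm
  · simpa using integral_nonneg fun x => norm_nonneg _
  have hm' : (0 : ℝ) < √m := by positivity
  have hcoord : ∀ i : Fin m, ∫ x, |x i| ∂(stdGaussian (EuclideanSpace ℝ (Fin m))) =
      ∫ x, |x| ∂(gaussianReal 0 1) := by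
    intro i
    rw [← map_pi_eq_stdGaussian, integral_map (by fun_prop) (by fun_prop)]
    exact integral_comp_eval (μ := fun _ : Fin m => gaussianReal 0 1) (i := i)
      (f := fun x => |x|) (by fun_prop)
  have hid : Integrable (fun x : EuclideanSpace ℝ (Fin m) => x) (stdGaussian _) :=
    IsGaussian.integrable_id
  have hle : ∀ x : EuclideanSpace ℝ (Fin m), ∑ i, |x i| ≤ √m * ‖x‖ := by
    intro x
    rw [EuclideanSpace.norm_eq, ← sqrt_mul (by positivity)]
    refine le_sqrt_of_sq_le ?_
    have := sq_sum_le_card_mul_sum_sq (s := Finset.univ) (f := fun i => |x i|)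
    simpa using this
  have hi : ∀ i : Fin m, Integrable (fun x : EuclideanSpace ℝ (Fin m) => |x i|)
      (stdGaussian _) := fun i => by
    refine hid.norm.mono' (by fun_prop) ?_
    filter_upwards with x
    simpa using PiLp.norm_apply_le x i
  have h := integral_mono (integrable_finsetSum _ fun i _ => hi i) (hid.norm.const_mul √m) hle
  rw [integral_finsetSum _ fun i _ => hi i, integral_const_mul] at h
  simp only [hcoord, Finset.sum_const, Finset.card_univ, Fintype.card_fin, nsmul_eq_mul] at h
  rw [← mul_le_mul_iff_right₀ hm']
  calc _ = (√m * √m) * ∫ x, |x| ∂(gaussianReal 0 1) := by ring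
    _ ≤ _ := by rw [mul_self_sqrt (by positivity)]; exact h

variable {ι : Type*} [Fintype ι]

/-- Linear combinations of independent standard Gaussian vectors. -/
lemma map_sum_smul_pi_stdGaussian (v : ι → ℝ) :
    (Measure.pi fun _ : ι => stdGaussian E).map (fun x => ∑ l, v l • x l) =
      (stdGaussian E).map (fun x => √(∑ l, v l ^ 2) • x) := by
  refine Measure.ext_of_charFun ?_
  ext s
  rw [charFun_apply, charFun_apply,
    integral_map (Measurable.aemeasurable (by fun_prop)) (by fun_prop),
    integral_map (by fun_prop) (by fun_prop)]
  have h : ∀ (c : ℝ), ∫ x : E, Complex.exp (inner ℝ (c • x) s * Complex.I) ∂(stdGaussian E) =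
      Complex.exp (-(c ^ 2 * ‖s‖ ^ 2) / 2) := by
    intro c
    have := charFun_stdGaussian (c • s)
    rw [charFun_apply] at this
    simp_rw [real_inner_smul_left, ← real_inner_smul_right]
    rw [this, norm_smul, ← Complex.ofReal_pow, mul_pow, norm_eq_abs, sq_abs]
    push_cast
    rfl
  rw [h]
  simp_rw [sum_inner, Complex.ofReal_sum, Finset.sum_mul, Complex.exp_sum]
  rw [integral_fintype_prod_eq_prod
    (f := fun l (x : E) => Complex.exp (inner ℝ (v l • x) s * Complex.I))]
  simp_rw [h]
  rw [← Complex.exp_sum, ← Complex.ofReal_pow √_, sq_sqrt (by positivity)]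
  congr 1
  push_cast
  rw [Finset.sum_mul, ← Finset.sum_neg_distrib, Finset.sum_div]

/-- Simultaneous concentration along finitely many coefficient vectors. -/
lemma exists_forall_abs_norm_sum_smul_sub_lt (A : E →L[ℝ] F) (hA : ∀ x, ‖A x‖ ≤ ‖x‖)
    {κ : Type*} [Fintype κ] (v : κ → ι → ℝ) (hv : ∀ k, 0 < ∑ l, v k l ^ 2) {r : ℝ} (hr : 0 ≤ r)
    (hcard : Fintype.card κ * (4 * exp (-r ^ 2 / 8)) < 1) :
    ∃ x : ι → E, ∀ k, |‖A (∑ l, v k l • x l)‖ -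
      √(∑ l, v k l ^ 2) * ∫ y, ‖A y‖ ∂(stdGaussian E)| < √(∑ l, v k l ^ 2) * r := by
  set M := ∫ y, ‖A y‖ ∂(stdGaussian E) with hM
  set P := Measure.pi fun _ : ι => stdGaussian E with hP
  set B : κ → Set (ι → E) := fun k => {x | √(∑ l, v k l ^ 2) * r ≤
    |‖A (∑ l, v k l • x l)‖ - √(∑ l, v k l ^ 2) * M|} with hB
  have hBk : ∀ k, P (B k) ≤ ENNReal.ofReal (4 * exp (-r ^ 2 / 8)) := by
    intro k
    have hs : 0 < √(∑ l, v k l ^ 2) := sqrt_pos.2 (hv k)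
    set s := √(∑ l, v k l ^ 2) with hsdef
    have hmeas : MeasurableSet {y : E | s * r ≤ |‖A y‖ - s * M|} :=
      (isClosed_le continuous_const (by fun_prop)).measurableSet
    have h1 : P (B k) = P.map (fun x => ∑ l, v k l • x l) {y : E | s * r ≤ |‖A y‖ - s * M|} := by
      rw [Measure.map_apply (by fun_prop) hmeas]; rfl
    rw [h1, map_sum_smul_pi_stdGaussian, Measure.map_apply (by fun_prop) hmeas]
    refine le_trans (measure_mono fun x hx => ?_) (stdGaussian_abs_norm_sub_mean_ge_le A hA hr)
    have hx' : s * r ≤ |‖A (s • x)‖ - s * M| := hx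
    rw [map_smul, norm_smul, norm_of_nonneg hs.le, ← mul_sub, abs_mul, abs_of_pos hs] at hx'
    exact le_of_mul_le_mul_left hx' hs
  have hlt : P (⋃ k, B k) < 1 := by
    calc P (⋃ k, B k) ≤ ∑ k, P (B k) := measure_iUnion_fintype_le _ _
      _ ≤ ∑ _k : κ, ENNReal.ofReal (4 * exp (-r ^ 2 / 8)) := Finset.sum_le_sum fun k _ => hBk k
      _ = ENNReal.ofReal (Fintype.card κ * (4 * exp (-r ^ 2 / 8))) := by
          rw [Finset.sum_const, Finset.card_univ, nsmul_eq_mul,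
            ENNReal.ofReal_mul (Nat.cast_nonneg _), ENNReal.ofReal_natCast]
      _ < 1 := by rwa [ENNReal.ofReal_lt_one]
  have hne : (⋃ k, B k) ≠ Set.univ := by
    intro h
    rw [h, measure_univ] at hlt
    exact lt_irrefl _ hlt
  obtain ⟨x, hx⟩ := (Set.ne_univ_iff_exists_notMem _).1 hne
  refine ⟨x, fun k => ?_⟩
  by_contra! hk
  exact hx (Set.mem_iUnion.2 ⟨k, hk⟩)

end Gaussian

section Deterministic

/-- A vector-valued map whose components are concave and bounded by `t / 4` on the ball of
radius `2 * t` has a fixed point. -/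
lemma exists_fixedPoint_of_concaveOn {ι : Type*} [Fintype ι] {t : ℝ} (ht : 0 < t)
    (Φ : (ι → ℝ) → ι → ℝ) (hconv : ∀ i, ConcaveOn ℝ Set.univ fun b => Φ b i)
    (hbd : ∀ b, ‖b‖ ≤ 2 * t → ∀ i, |Φ b i| ≤ t / 4) :
    ∃ b, ‖b‖ ≤ 2 * t ∧ Φ b = b := by
  have hr : t / 2 < 2 * t - t := by linarith
  have hlip : LipschitzOnWith (1 / 2) Φ (Metric.closedBall 0 (t / 2)) := by
    rw [lipschitzOnWith_iff_dist_le_mul]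
    intro x hx y hy
    refine (dist_pi_le_iff (by positivity)).2 fun i => ?_
    have h := ((hconv i).subset (Set.subset_univ _)
      (convex_ball (0 : ι → ℝ) (2 * t))).lipschitzOnWith_of_abs_le ht (M := t / 4)
      (fun a ha => hbd a (by simpa using ha.le) i)
    have h2 : (2 * (t / 4) / t).toNNReal = 1 / 2 := by
      rw [show 2 * (t / 4) / t = 1 / 2 by field_simp; norm_num]
      ext; simp
    rw [h2] at h
    have hsub := Metric.closedBall_subset_ball (x := (0 : ι → ℝ)) hr
    exact h.dist_le_mul x (hsub hx) y (hsub hy)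
  have hmaps : Set.MapsTo Φ (Metric.closedBall 0 (t / 2)) (Metric.closedBall 0 (t / 2)) := by
    intro x hx
    rw [mem_closedBall_zero_iff] at hx ⊢
    refine (pi_norm_le_iff_of_nonneg (by positivity)).2 fun i => ?_
    exact (hbd x (by linarith) i).trans (by linarith)
  obtain ⟨b, hb, hfix, -⟩ := ContractingWith.exists_fixedPoint'
    Metric.isClosed_closedBall.isComplete hmaps
    (K := 1 / 2) ⟨by
      rw [← NNReal.coe_lt_coe]; norm_num, hlip.mapsToRestrict hmaps⟩
    (Metric.mem_closedBall_self (by positivity)) (edist_ne_top _ _)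
  rw [mem_closedBall_zero_iff] at hb
  exact ⟨b, by linarith, hfix⟩

variable {F : Type*} [NormedAddCommGroup F] [NormedSpace ℝ F]
  {ι : Type*} [Fintype ι]

/-- A vector coefficient family having entries `1` at `i`, `-1` at `j` and `±T` elsewhere. -/
def IsEdgeVertex (T : ℝ) (i j : ι) (v : ι → ℝ) : Prop :=
  v i = 1 ∧ v j = -1 ∧ ∀ l, l ≠ i → l ≠ j → |v l| = T

lemma norm_sum_smul_le_of_isEdgeVertex [DecidableEq ι] {x : ι → F} {T C : ℝ} (hT : 0 ≤ T) {i j : ι}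
    (hij : i ≠ j) (h : ∀ v, IsEdgeVertex T i j v → ‖∑ l, v l • x l‖ ≤ C)
    {a : ι → ℝ} (hai : a i = 1) (haj : a j = -1) (ha : ∀ l, l ≠ i → l ≠ j → |a l| ≤ T) :
    ‖∑ l, a l • x l‖ ≤ C := by
  set s : ι → Set ℝ := fun l => if l = i then {1} else if l = j then {-1} else {-T, T} with hs
  have hmem : a ∈ convexHull ℝ (Set.univ.pi s) := by
    rw [convexHull_pi]
    intro l _
    by_cases hli : l = i
    · subst hli; simp [hs, hai]
    by_cases hlj : l = j
    · subst hlj; simp [hs, hij.symm, haj]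
    simp only [hs, hli, hlj, if_false, convexHull_pair]
    rw [segment_eq_Icc (by linarith)]
    exact abs_le.1 (ha l hli hlj)
  have hconv : Convex ℝ {b : ι → ℝ | ‖∑ l, b l • x l‖ ≤ C} := by
    have heq : {b : ι → ℝ | ‖∑ l, b l • x l‖ ≤ C} =
        Fintype.linearCombination ℝ x ⁻¹' Metric.closedBall 0 C := by
      ext b
      simp [Fintype.linearCombination_apply]
    rw [heq]
    exact (convex_closedBall (0 : F) C).linear_preimage _
  refine convexHull_min ?_ hconv hmem
  intro v hv
  refine h v ⟨?_, ?_, fun l hli hlj => ?_⟩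
  · simpa [hs] using hv i (Set.mem_univ _)
  · simpa [hs, hij.symm] using hv j (Set.mem_univ _)
  · have := hv l (Set.mem_univ _)
    simp only [hs, hli, hlj, if_false, Set.mem_insert_iff, Set.mem_singleton_iff] at this
    rcases this with h | h <;> simp [h, abs_of_nonneg hT]

lemma abs_norm_sum_smul_sub_le [DecidableEq ι] {x : ι → F} {T D η : ℝ} (hT : 0 ≤ T)
    {i j : ι} (hij : i ≠ j) (hlow : D * (1 - η) ≤ ‖x i - x j‖)
    (hup : ∀ v, IsEdgeVertex T i j v → ‖∑ l, v l • x l‖ ≤ D * (1 + η)) (hη : 0 ≤ D * η)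
    {a : ι → ℝ} (hai : a i = 1) (haj : a j = -1) (ha : ∀ l, l ≠ i → l ≠ j → |a l| ≤ T) :
    |‖∑ l, a l • x l‖ - D| ≤ 3 * (D * η) := by
  have h1 := norm_sum_smul_le_of_isEdgeVertex hT hij hup hai haj ha
  set e : ι → ℝ := Pi.single i 1 - Pi.single j 1 with he
  have hex : ∑ l, e l • x l = x i - x j := by
    simp [he, sub_smul, Finset.sum_sub_distrib, Pi.single_apply, ite_smul]
  have h2 := norm_sum_smul_le_of_isEdgeVertex (a := (2 : ℝ) • e - a) hT hij hup
    (by simp [he, hij, hai]; norm_num) (by simp [he, hij.symm, haj]; norm_num)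
    (fun l hli hlj => by simpa [he, hli, hlj] using ha l hli hlj)
  have h3 : (2 : ℝ) • (x i - x j) = ∑ l, a l • x l + ∑ l, ((2 : ℝ) • e - a) l • x l := by
    rw [← hex, Finset.smul_sum, ← Finset.sum_add_distrib]
    refine Finset.sum_congr rfl fun l _ => ?_
    simp only [Pi.sub_apply, Pi.smul_apply, smul_eq_mul]
    module
  have h4 : 2 * ‖x i - x j‖ ≤ ‖∑ l, a l • x l‖ + ‖∑ l, ((2 : ℝ) • e - a) l • x l‖ := by
    calc 2 * ‖x i - x j‖ = ‖(2 : ℝ) • (x i - x j)‖ := by rw [norm_smul]; simp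
      _ ≤ _ := by rw [h3]; exact norm_add_le _ _
  rw [abs_le]
  constructor <;> linarith

/-- Perturbing an approximately equilateral family into an exactly equilateral one. -/
theorem exists_equilateral_family [DecidableEq ι] {x : ι → F} {t D : ℝ} (ht : 0 < t)
    (ht4 : t ≤ 1 / 4) (hD : 0 < D)
    (hlow : ∀ i j, i ≠ j → D * (1 - t / 20) ≤ ‖x i - x j‖)
    (hup : ∀ i j, i ≠ j → ∀ v, IsEdgeVertex (8 * t) i j v →
      ‖∑ l, v l • x l‖ ≤ D * (1 + t / 20)) :
    ∃ p : ι → F, ∀ i j, i ≠ j → ‖p i - p j‖ = D := by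
  -- coefficients of the perturbed points
  set q : (Sym2 ι → ℝ) → ι → ι → ℝ := fun b i l => if l = i then 1 else -b s(i, l) with hq
  set p : (Sym2 ι → ℝ) → ι → F := fun b i => ∑ l, q b i l • x l with hp
  have hpsub : ∀ b i j, p b i - p b j = ∑ l, (q b i l - q b j l) • x l := fun b i j => by
    simp [hp, sub_smul, Finset.sum_sub_distrib]
  set G : (Sym2 ι → ℝ) → ι → ι → ℝ := fun b i j =>
    if i = j then 0 else 1 + b s(i, j) - D⁻¹ * ‖p b i - p b j‖ with hG
  set Φ : (Sym2 ι → ℝ) → Sym2 ι → ℝ := fun b =>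
    Sym2.lift ⟨G b, fun i j => by simp only [hG, eq_comm, Sym2.eq_swap, norm_sub_rev]⟩ with hΦ
  have hΦG : ∀ b i j, Φ b s(i, j) = G b i j := fun b i j => rfl
  obtain ⟨b, hb, hfix⟩ := exists_fixedPoint_of_concaveOn ht Φ
    (fun z => by
      induction z using Sym2.ind with
      | _ i j =>
        simp only [hΦG, hG]
        by_cases hij : i = j
        · simp only [hij, if_true]; exact concaveOn_const _ convex_univ
        simp only [hij, if_false]
        refine ⟨convex_univ, fun b₁ _ b₂ _ α β hα hβ hαβ => ?_⟩
        have hlin : p (α • b₁ + β • b₂) i - p (α • b₁ + β • b₂) j =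
            α • (p b₁ i - p b₁ j) + β • (p b₂ i - p b₂ j) := by
          simp only [hpsub, Finset.smul_sum, ← Finset.sum_add_distrib]
          refine Finset.sum_congr rfl fun l _ => ?_
          rw [smul_smul, smul_smul, ← add_smul]
          congr 1
          obtain rfl : β = 1 - α := by linarith
          simp only [hq, Pi.add_apply, Pi.smul_apply, smul_eq_mul]
          split_ifs <;> ring
        have hn : ‖p (α • b₁ + β • b₂) i - p (α • b₁ + β • b₂) j‖ ≤
            α * ‖p b₁ i - p b₁ j‖ + β * ‖p b₂ i - p b₂ j‖ := by
          rw [hlin]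
          refine (norm_add_le _ _).trans (le_of_eq ?_)
          rw [norm_smul, norm_smul, Real.norm_of_nonneg hα, Real.norm_of_nonneg hβ]
        have := mul_le_mul_of_nonneg_left hn (inv_pos.2 hD).le
        simp only [Pi.add_apply, Pi.smul_apply, smul_eq_mul]
        linear_combination this + hαβ)
    (fun b hb z => by
      induction z using Sym2.ind with
      | _ i j =>
        simp only [hΦG, hG]
        by_cases hij : i = j
        · simp only [hij, if_true, abs_zero]; positivity
        simp only [hij, if_false]
        have hbz : ∀ z, |b z| ≤ 2 * t := fun z => (norm_le_pi_norm b z).trans hb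
        have hβ := abs_le.1 (hbz s(i, j))
        set β := b s(i, j) with hβdef
        have hβ0 : 0 < 1 + β := by linarith
        set a : ι → ℝ := fun l => (1 + β)⁻¹ * (q b i l - q b j l) with ha
        have key := abs_norm_sum_smul_sub_le (x := x) (T := 8 * t) (D := D) (η := t / 20)
          (by positivity) hij (hlow i j hij) (hup i j hij) (by positivity) (a := a)
          (by simp [ha, hq, hij, Sym2.eq_swap (a := j), ← hβdef]; field_simp)
          (by simp [ha, hq, Ne.symm hij, ← hβdef]; field_simp; ring)
          (fun l hli hlj => by
            simp only [ha, hq, hli, hlj, if_false]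
            rw [abs_mul, abs_of_pos (inv_pos.2 hβ0)]
            have h1 : |-b s(i, l) - -b s(j, l)| ≤ 4 * t := by
              have h1 := abs_le.1 (hbz s(i, l))
              have h2 := abs_le.1 (hbz s(j, l))
              rw [abs_le]; constructor <;> linarith
            have h2 : (1 + β)⁻¹ ≤ 2 := by
              rw [inv_le_comm₀ hβ0 two_pos]; linarith
            calc _ ≤ 2 * (4 * t) := by gcongr
              _ = 8 * t := by ring)
        have hpa : p b i - p b j = (1 + β) • ∑ l, a l • x l := by
          rw [hpsub, Finset.smul_sum]
          refine Finset.sum_congr rfl fun l _ => ?_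
          rw [smul_smul]
          congr 1
          simp only [ha]
          field_simp
        rw [hpa, norm_smul, Real.norm_of_nonneg hβ0.le]
        set n := ‖∑ l, a l • x l‖
        have : 1 + β - D⁻¹ * ((1 + β) * n) = -((1 + β) * D⁻¹ * (n - D)) := by
          field_simp; ring
        rw [this, abs_neg, abs_mul, abs_of_pos (by positivity)]
        calc (1 + β) * D⁻¹ * |n - D| ≤ (3 / 2) * D⁻¹ * (3 * (D * (t / 20))) := by
              gcongr; linarith
          _ = 9 / 40 * t := by field_simp; norm_num
          _ ≤ t / 4 := by linarith)
  refine ⟨p b, fun i j hij => ?_⟩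
  have := congrFun hfix s(i, j)
  simp only [hΦG, hG, hij, if_false] at this
  have h1 : D⁻¹ * ‖p b i - p b j‖ = 1 := by linarith
  field_simp at h1
  exact h1

end Deterministic

section Assembly

/-- The coefficient vector with entries `1` at `i`, `-1` at `j` and `±T` elsewhere, the signs being
prescribed by `s`. -/
def edgeVertex {ι : Type*} [DecidableEq ι] (T : ℝ) (i j : ι) (s : ι → Bool) (l : ι) : ℝ :=
  if l = i then 1 else if l = j then -1 else if s l then T else -T

lemma IsEdgeVertex.exists_eq_edgeVertex {ι : Type*} [DecidableEq ι] {T : ℝ} {i j : ι} {v : ι → ℝ}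
    (hv : IsEdgeVertex T i j v) : ∃ s, v = edgeVertex T i j s := by
  classical
  refine ⟨fun l => decide (v l = T), funext fun l => ?_⟩
  unfold edgeVertex
  split_ifs with hi hj hs
  · rw [hi, hv.1]
  · rw [hj, hv.2.1]
  · simpa using hs
  · exact (eq_or_eq_neg_of_abs_eq (hv.2.2 l hi hj)).resolve_left (by simpa using hs)

lemma sum_edgeVertex_sq_pos {ι : Type*} [Fintype ι] [DecidableEq ι] (T : ℝ) (i j : ι)
    (s : ι → Bool) : 0 < ∑ l, edgeVertex T i j s l ^ 2 :=
  Finset.sum_pos' (fun _ _ => sq_nonneg _) ⟨i, Finset.mem_univ _, by simp [edgeVertex]⟩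

lemma two_le_sum_edgeVertex_sq {ι : Type*} [Fintype ι] [DecidableEq ι] (T : ℝ) {i j : ι}
    (hij : i ≠ j) (s : ι → Bool) : 2 ≤ ∑ l, edgeVertex T i j s l ^ 2 := by
  have h : ∑ l : ι, ((if l = i then 1 else 0) + (if l = j then 1 else 0) : ℝ) = 2 := by
    simp [Finset.sum_add_distrib]; norm_num
  rw [← h]
  refine Finset.sum_le_sum fun l _ => ?_
  unfold edgeVertex
  split_ifs <;> simp_all [sq_nonneg]

lemma sum_edgeVertex_sq_le {ι : Type*} [Fintype ι] [DecidableEq ι] (T : ℝ) (i j : ι)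
    (s : ι → Bool) : ∑ l, edgeVertex T i j s l ^ 2 ≤ 2 + Fintype.card ι * T ^ 2 := by
  have h : ∑ l : ι, ((if l = i then 1 else 0) + (if l = j then 1 else 0) + T ^ 2 : ℝ) =
      2 + Fintype.card ι * T ^ 2 := by
    simp [Finset.sum_add_distrib]; norm_num
  rw [← h]
  refine Finset.sum_le_sum fun l _ => ?_
  have := sq_nonneg T
  unfold edgeVertex
  split_ifs <;> simp <;> linarith

lemma card_mul_exp_lt_one {N : ℕ} (hN : 1 ≤ N) {r : ℝ} (hr : 56 * N ≤ r ^ 2) :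
    (Fintype.card (Fin N × Fin N × (Fin N → Bool) × Bool) : ℝ) * (4 * exp (-r ^ 2 / 8)) < 1 := by
  have hN1 : (1 : ℝ) ≤ N := by exact_mod_cast hN
  have hN2 : (N : ℝ) ≤ 2 ^ N := by exact_mod_cast Nat.lt_two_pow_self.le
  have h8 : (8 : ℝ) ≤ 8 ^ N := le_self_pow₀ (by norm_num) (by omega)
  have hexp : (64 : ℝ) ^ N ≤ exp (6 * N) := by
    have h2 : (2 : ℝ) ≤ exp 1 := by linarith [add_one_le_exp (1 : ℝ)]
    calc (64 : ℝ) ^ N = (2 ^ 6) ^ N := by norm_num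
      _ ≤ (exp 1 ^ 6) ^ N := by gcongr
      _ = exp (6 * N) := by rw [← exp_nat_mul, ← exp_nat_mul]; congr 1; push_cast; ring
  have hpow : (64 : ℝ) ^ N = 8 ^ N * (2 ^ N * 2 ^ N * 2 ^ N) := by
    rw [← mul_pow, ← mul_pow, ← mul_pow]; norm_num
  have hcard : (Fintype.card (Fin N × Fin N × (Fin N → Bool) × Bool) : ℝ) * 4 ≤ 64 ^ N := by
    simp only [Fintype.card_prod, Fintype.card_fin, Fintype.card_fun, Fintype.card_bool]
    push_cast
    calc (N : ℝ) * (N * (2 ^ N * 2)) * 4 = 8 * (N * N * 2 ^ N) := by ring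
      _ ≤ 8 ^ N * (2 ^ N * 2 ^ N * 2 ^ N) := by gcongr
      _ = _ := hpow.symm
  calc _ = (Fintype.card (Fin N × Fin N × (Fin N → Bool) × Bool) : ℝ) * 4 * exp (-r ^ 2 / 8) := by
        ring
    _ ≤ exp (6 * N) * exp (-r ^ 2 / 8) := by gcongr; exact hcard.trans hexp
    _ = exp (6 * N + -r ^ 2 / 8) := (exp_add _ _).symm
    _ < 1 := by rw [exp_lt_one_iff]; linarith

/-- A Euclidean space of dimension of order `N ^ 3`, renormed with distortion at most `2`,
contains `N` equidistant points. -/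
theorem exists_equilateral_family_of_norm_le {F : Type*} [NormedAddCommGroup F] [NormedSpace ℝ F]
    {m N : ℕ} (hN : 1 ≤ N) (A : EuclideanSpace ℝ (Fin m) →L[ℝ] F) (hA : ∀ x, ‖A x‖ ≤ ‖x‖)
    (hA' : ∀ x, ‖x‖ ≤ 2 * ‖A x‖)
    (hm : 56 / ((∫ x, |x| ∂(gaussianReal 0 1)) / 320000) ^ 2 * (N : ℝ) ^ 3 ≤ m) :
    ∃ D : ℝ, 0 < D ∧ ∃ p : Fin N → F, ∀ i j, i ≠ j → ‖p i - p j‖ = D := by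
  have hc₁ := integral_abs_gaussianReal_pos
  have hmean := mul_sqrt_le_integral_norm_stdGaussian m
  set c₁ := ∫ x, |x| ∂(gaussianReal 0 1) with hc₁def
  have hN0 : (0 : ℝ) < N := by exact_mod_cast hN
  have hm0 : (0 : ℝ) < m := lt_of_lt_of_le (by positivity) hm
  set M := ∫ y, ‖A y‖ ∂(stdGaussian (EuclideanSpace ℝ (Fin m))) with hMdef
  have hM : c₁ * √m ≤ 2 * M := by
    refine hmean.trans ?_
    rw [hMdef, ← integral_const_mul]
    have hid : Integrable (fun x : EuclideanSpace ℝ (Fin m) => x) (stdGaussian _) :=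
      IsGaussian.integrable_id
    exact integral_mono hid.norm ((integrable_norm_apply_stdGaussian A).const_mul 2) hA'
  have hMpos : 0 < M := by
    have : 0 < c₁ * √m := by positivity
    linarith
  set t : ℝ := 1 / (1600 * N) with ht
  have htpos : 0 < t := by positivity
  have hNt : N * t = 1 / 1600 := by rw [ht]; field_simp
  have ht1 : t ≤ 1 / 1600 := by
    rw [← hNt]
    exact le_mul_of_one_le_left htpos.le (by exact_mod_cast hN)
  set r := t * M / 100 with hr
  have hr56 : 56 * N ≤ r ^ 2 := by
    have h1 : c₁ / 320000 * √m / N ≤ r := by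
      have : r = M / (160000 * N) := by rw [hr, ht]; field_simp; norm_num
      rw [this, div_le_div_iff₀ hN0 (by positivity)]
      nlinarith
    have h2 : (c₁ / 320000 * √m / N) ^ 2 ≤ r ^ 2 := pow_le_pow_left₀ (by positivity) h1 2
    refine le_trans ?_ h2
    rw [div_pow, mul_pow, sq_sqrt hm0.le, le_div_iff₀ (by positivity)]
    rw [div_mul_eq_mul_div, div_le_iff₀ (by positivity)] at hm
    linarith
  obtain ⟨x, hx⟩ := exists_forall_abs_norm_sum_smul_sub_lt A hA
    (fun k : Fin N × Fin N × (Fin N → Bool) × Bool =>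
      edgeVertex (if k.2.2.2 then 8 * t else 0) k.1 k.2.1 k.2.2.1)
    (fun k => sum_edgeVertex_sq_pos _ _ _ _) (show 0 ≤ r by positivity)
    (card_mul_exp_lt_one hN hr56)
  refine ⟨√2 * M, by positivity, exists_equilateral_family (x := fun l => A (x l)) htpos
    (by linarith) (by positivity) (fun i j hij => ?_) (fun i j hij v hv => ?_)⟩
  · have h := (abs_lt.1 (hx (i, j, fun _ => true, false))).1
    have hsum : ∑ l, edgeVertex 0 i j (fun _ => true) l • x l = x i - x j := by
      have : edgeVertex 0 i j (fun _ => true) = Pi.single i 1 - Pi.single j 1 := by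
        funext l
        by_cases hi : l = i
        · subst hi; simp [edgeVertex, hij]
        by_cases hj : l = j
        · subst hj; simp [edgeVertex, hi]
        simp [edgeVertex, hi, hj]
      rw [this]
      simp [sub_smul, Finset.sum_sub_distrib, Pi.single_apply, ite_smul]
    simp only [Bool.false_eq_true, if_false, hsum, map_sub] at h
    have hs : √2 ≤ √(∑ l, edgeVertex 0 i j (fun _ => true) l ^ 2) :=
      sqrt_le_sqrt (two_le_sum_edgeVertex_sq _ hij _)
    have hMr : M * (1 - t / 20) ≤ M - r := by
      rw [hr]; nlinarith [mul_pos htpos hMpos]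
    calc √2 * M * (1 - t / 20) = √2 * (M * (1 - t / 20)) := by ring
      _ ≤ √(∑ l, edgeVertex 0 i j (fun _ => true) l ^ 2) * (M - r) := by
          gcongr
          exact mul_nonneg hMpos.le (by linarith)
      _ ≤ _ := by linarith
  · obtain ⟨s, rfl⟩ := hv.exists_eq_edgeVertex
    have h := (abs_lt.1 (hx (i, j, s, true))).2
    simp only [if_true, map_sum, map_smul] at h
    have hs : √(∑ l, edgeVertex (8 * t) i j s l ^ 2) ≤ √2 * (1 + t / 100) := by
      rw [← sqrt_sq (show 0 ≤ 1 + t / 100 by positivity), ← sqrt_mul zero_le_two]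
      refine sqrt_le_sqrt ((sum_edgeVertex_sq_le _ _ _ _).trans ?_)
      rw [Fintype.card_fin]
      have : (N : ℝ) * (8 * t) ^ 2 = 64 * (N * t) * t := by ring
      rw [this, hNt]
      nlinarith
    calc _ ≤ √(∑ l, edgeVertex (8 * t) i j s l ^ 2) * (M + r) := by linarith
      _ ≤ √2 * (1 + t / 100) * (M + r) := by gcongr
      _ = √2 * M * (1 + t / 100) ^ 2 := by rw [hr]; ring
      _ ≤ √2 * M * (1 + t / 20) := by gcongr; nlinarith

/-- A space at small Banach–Mazur distance from a Euclidean space is a contractive image of it with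
controlled inverse. -/
lemma exists_norm_le_of_BMdist_lt_two {Y : Type*} [NormedAddCommGroup Y] [NormedSpace ℝ Y]
    [FiniteDimensional ℝ Y] {m : ℕ} (hm : 0 < m) (hY : Module.finrank ℝ Y = m)
    (h : BMdist Y (EuclideanSpace ℝ (Fin m)) < 2) :
    ∃ A : EuclideanSpace ℝ (Fin m) →L[ℝ] Y, (∀ x, ‖A x‖ ≤ ‖x‖) ∧ ∀ x, ‖x‖ ≤ 2 * ‖A x‖ := by
  have hne : {r : ℝ | ∃ T : Y ≃L[ℝ] EuclideanSpace ℝ (Fin m),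
      r = ‖(T : Y →L[ℝ] EuclideanSpace ℝ (Fin m))‖ *
        ‖(T.symm : EuclideanSpace ℝ (Fin m) →L[ℝ] Y)‖}.Nonempty :=
    ⟨_, ContinuousLinearEquiv.ofFinrankEq (by simp [hY]), rfl⟩
  obtain ⟨_, ⟨T, rfl⟩, hT⟩ := exists_lt_of_csInf_lt hne h
  set S : EuclideanSpace ℝ (Fin m) →L[ℝ] Y := T.symm.toContinuousLinearMap with hS
  have hTS : ∀ x, ‖x‖ ≤ ‖(T : Y →L[ℝ] EuclideanSpace ℝ (Fin m))‖ * ‖S x‖ := fun x => by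
    simpa [hS] using (T : Y →L[ℝ] EuclideanSpace ℝ (Fin m)).le_opNorm (S x)
  have hS0 : 0 < ‖S‖ := by
    rw [norm_pos_iff]
    intro h0
    have := hTS (EuclideanSpace.single ⟨0, hm⟩ 1)
    rw [h0] at this
    simp at this
    linarith
  refine ⟨‖S‖⁻¹ • S, fun x => ?_, fun x => ?_⟩
  · rw [smul_apply, norm_smul, norm_inv, norm_norm, inv_mul_le_iff₀ hS0]
    exact S.le_opNorm x
  · rw [smul_apply, norm_smul, norm_inv, norm_norm]
    calc ‖x‖ ≤ ‖(T : Y →L[ℝ] EuclideanSpace ℝ (Fin m))‖ * ‖S x‖ := hTS x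
      _ = (‖(T : Y →L[ℝ] EuclideanSpace ℝ (Fin m))‖ * ‖S‖) * (‖S‖⁻¹ * ‖S x‖) := by field_simp
      _ ≤ 2 * (‖S‖⁻¹ * ‖S x‖) := by gcongr

end Assembly

/-- There is an absolute constant `c > 0` with the following property: if a
finite-dimensional real normed space `X` has an `m`-dimensional linear subspace `Y`
(with the induced norm) whose Banach–Mazur distance from `ℓ₂ᵐ` (Euclidean space) is
at most `3/2`, then `X` contains an equilateral set of at least `c m^{1/3}` points,
i.e. `e(X) ≥ c m^{1/3}`. -/
theorem equilateral_of_subspace_bmdist_l2_le :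
    ∃ c : ℝ, 0 < c ∧
      ∀ (X : Type*) [NormedAddCommGroup X] [NormedSpace ℝ X] [FiniteDimensional ℝ X]
        (m : ℕ) (Y : Submodule ℝ X), Module.finrank ℝ Y = m →
        BMdist Y (EuclideanSpace ℝ (Fin m)) ≤ 3 / 2 →
        ∃ S : Finset X, IsEquilateral (S : Set X) ∧
          c * (m : ℝ) ^ ((1 : ℝ) / 3) ≤ (S.card : ℝ) := by
  set C : ℝ := 56 / ((∫ x, |x| ∂(gaussianReal 0 1)) / 320000) ^ 2 with hC
  have hCpos : 0 < C := by
    have := integral_abs_gaussianReal_pos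
    positivity
  refine ⟨(C⁻¹) ^ ((1 : ℝ) / 3) / 2, by positivity, ?_⟩
  intro X _ _ _ m Y hY hd
  set u : ℝ := (C⁻¹ * m) ^ ((1 : ℝ) / 3) with hu
  have hu0 : 0 ≤ u := by positivity
  have hu3 : u ^ 3 = C⁻¹ * m := by
    rw [hu, ← rpow_natCast, ← rpow_mul (by positivity)]
    norm_num
  have hcu : (C⁻¹) ^ ((1 : ℝ) / 3) / 2 * (m : ℝ) ^ ((1 : ℝ) / 3) = u / 2 := by
    rw [hu, mul_rpow (by positivity) (by positivity)]
    ring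
  rw [hcu]
  have hlt : u < ⌊u⌋₊ + 1 := Nat.lt_floor_add_one u
  rcases Nat.eq_zero_or_pos ⌊u⌋₊ with h0 | hN
  · refine ⟨{0}, ⟨1, one_pos, by simp⟩, ?_⟩
    rw [h0] at hlt
    simp at hlt ⊢
    linarith
  have hN1 : (1 : ℝ) ≤ ⌊u⌋₊ := by exact_mod_cast hN
  have hNm : C * (⌊u⌋₊ : ℝ) ^ 3 ≤ m := by
    calc C * (⌊u⌋₊ : ℝ) ^ 3 ≤ C * u ^ 3 := by gcongr; exact Nat.floor_le hu0
      _ = (m : ℝ) := by rw [hu3]; field_simp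
  have hm : 0 < m := by
    have : (0 : ℝ) < m := lt_of_lt_of_le (by positivity) hNm
    exact_mod_cast this
  obtain ⟨A, hA, hA'⟩ := exists_norm_le_of_BMdist_lt_two hm hY (by linarith)
  obtain ⟨D, hD, p, hp⟩ := exists_equilateral_family_of_norm_le hN A hA hA' hNm
  have hpX : ∀ i j, i ≠ j → ‖(p i : X) - p j‖ = D := fun i j hij => by
    simpa using hp i j hij
  have hinj : Function.Injective fun i => (p i : X) := by
    intro i j hij
    by_contra hne
    have := hpX i j hne
    rw [sub_eq_zero.2 hij, norm_zero] at this
    linarith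
  refine ⟨Finset.univ.map ⟨_, hinj⟩, ⟨D, hD, ?_⟩, ?_⟩
  · intro x hx y hy hxy
    simp only [Finset.coe_map, Finset.coe_univ, Set.image_univ, Set.mem_range,
      Function.Embedding.coeFn_mk] at hx hy
    obtain ⟨i, rfl⟩ := hx
    obtain ⟨j, rfl⟩ := hy
    exact hpX i j fun h => hxy (by rw [h])
  · rw [Finset.card_map, Finset.card_univ, Fintype.card_fin]
    linarith
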